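/- Let f : ℝ^m → ℝ be differentiable with L_eq-Lipschitz gradient (L_eq > 0), bounded below, and let 0 < γ ≤ 1/L_eq. If x* is a cluster point of the gradient descent sequence x_{n+1} = x_n − γ∇f(x_n), then ∇f(x*) = 0; that is, every accumulation point of the iterates is a critical point of the MAP objective f. -/

import Mathlib

open Filter Topology

section GradientDescent

variable {E : Type*} [NormedAddCommGroup E] [InnerProductSpace ℝ E] [CompleteSpace E]
  {f : E → ℝ} {L γ : ℝ}

/-- The descent lemma: a function with `L`-Lipschitz gradient lies below its quadratic model. -/
theorem le_add_inner_gradient_add_sq (hf : Differentiable ℝ f)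
    (hlip : ∀ x y, ‖gradient f x - gradient f y‖ ≤ L * ‖x - y‖) (x v : E) :
    f (x + v) ≤ f x + inner ℝ (gradient f x) v + L / 2 * ‖v‖ ^ 2 := by
  have hderiv (t : ℝ) :
      HasDerivAt (fun t : ℝ => f (x + t • v)) (inner ℝ (gradient f (x + t • v)) v) t := by
    have hline : HasDerivAt (fun t : ℝ => x + t • v) v t := by
      simpa using ((hasDerivAt_id t).smul_const v).const_add x
    simpa [Function.comp_def] using
      (hf (x + t • v)).hasGradientAt.hasFDerivAt.comp_hasDerivAt t hline
  have hmodel (t : ℝ) : HasDerivAt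
      (fun t : ℝ => f x + t * inner ℝ (gradient f x) v + L / 2 * ‖v‖ ^ 2 * t ^ 2)
      (inner ℝ (gradient f x) v + L * ‖v‖ ^ 2 * t) t := by
    have h := (((hasDerivAt_id t).mul_const (inner ℝ (gradient f x) v)).const_add (f x)).add
      ((hasDerivAt_pow 2 t).const_mul (L / 2 * ‖v‖ ^ 2))
    exact h.congr_deriv (by push_cast; ring)
  have hbound : ∀ t ∈ Set.Ico (0 : ℝ) 1, inner ℝ (gradient f (x + t • v)) v ≤
      inner ℝ (gradient f x) v + L * ‖v‖ ^ 2 * t := by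
    intro t ht
    have hinner := real_inner_le_norm (gradient f (x + t • v) - gradient f x) v
    have hgrad := hlip (x + t • v) x
    rw [add_sub_cancel_left, norm_smul, Real.norm_of_nonneg ht.1] at hgrad
    rw [inner_sub_left] at hinner
    nlinarith [mul_le_mul_of_nonneg_right hgrad (norm_nonneg v)]
  have h := image_le_of_deriv_right_le_deriv_boundary
    (fun t _ => (hderiv t).continuousAt.continuousWithinAt)
    (fun t _ => (hderiv t).hasDerivWithinAt) (by simp)
    (fun t _ => (hmodel t).continuousAt.continuousWithinAt)
    (fun t _ => (hmodel t).hasDerivWithinAt) hbound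
    (Set.right_mem_Icc.2 (zero_le_one' ℝ))
  simpa using h

theorem gradient_step_sufficient_decrease (hf : Differentiable ℝ f) (hL : 0 < L)
    (hlip : ∀ x y, ‖gradient f x - gradient f y‖ ≤ L * ‖x - y‖)
    (hγ0 : 0 < γ) (hγ : γ ≤ 1 / L) (x : E) :
    γ / 2 * ‖gradient f x‖ ^ 2 ≤ f x - f (x - γ • gradient f x) := by
  have h := le_add_inner_gradient_add_sq hf hlip x (-(γ • gradient f x))
  rw [← sub_eq_add_neg, inner_neg_right, real_inner_smul_right, real_inner_self_eq_norm_sq,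
    norm_neg, norm_smul, Real.norm_of_nonneg hγ0.le] at h
  rw [le_div_iff₀ hL] at hγ
  nlinarith [mul_nonneg (mul_nonneg hγ0.le (sub_nonneg.2 hγ)) (sq_nonneg ‖gradient f x‖)]

theorem tendsto_gradient_of_gradient_descent (hf : Differentiable ℝ f) (hL : 0 < L)
    (hlip : ∀ x y, ‖gradient f x - gradient f y‖ ≤ L * ‖x - y‖)
    (hbdd : ∃ c : ℝ, ∀ x, c ≤ f x) (hγ0 : 0 < γ) (hγ : γ ≤ 1 / L) {x : ℕ → E}
    (hx : ∀ n, x (n + 1) = x n - γ • gradient f (x n)) :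
    Tendsto (fun n => gradient f (x n)) atTop (𝓝 0) := by
  obtain ⟨c, hc⟩ := hbdd
  have hdecr (n : ℕ) : γ / 2 * ‖gradient f (x n)‖ ^ 2 ≤ f (x n) - f (x (n + 1)) := by
    rw [hx n]
    exact gradient_step_sufficient_decrease hf hL hlip hγ0 hγ (x n)
  have hanti : Antitone fun n => f (x n) := antitone_nat_of_succ_le fun n =>
    sub_nonneg.1 ((by positivity : 0 ≤ γ / 2 * ‖gradient f (x n)‖ ^ 2).trans (hdecr n))
  have hlim := tendsto_atTop_ciInf hanti ⟨c, Set.forall_mem_range.2 fun n => hc (x n)⟩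
  have hdiff : Tendsto (fun n => f (x n) - f (x (n + 1))) atTop (𝓝 0) := by
    simpa using hlim.sub (hlim.comp (tendsto_add_atTop_nat 1))
  have hsq : Tendsto (fun n => ‖gradient f (x n)‖ ^ 2) atTop (𝓝 0) := by
    refine squeeze_zero (fun n => sq_nonneg _) (fun n => ?_)
      (by simpa using hdiff.const_mul (2 / γ))
    calc ‖gradient f (x n)‖ ^ 2 = 2 / γ * (γ / 2 * ‖gradient f (x n)‖ ^ 2) := by field_simp
      _ ≤ 2 / γ * (f (x n) - f (x (n + 1))) := by gcongr; exact hdecr n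
  rw [tendsto_zero_iff_norm_tendsto_zero]
  simpa using hsq.sqrt

end GradientDescent

/-- If `f` is differentiable with `L_eq`-Lipschitz gradient, bounded below, and
`0 < γ ≤ 1/L_eq`, then every cluster point (limit of a subsequence) of the gradient
descent iterates is a critical point of `f`. -/
theorem epnp_cluster_point_critical {m : ℕ} (f : EuclideanSpace ℝ (Fin m) → ℝ)
    (hf : Differentiable ℝ f) (L_eq : ℝ) (hL : 0 < L_eq)
    (hlip : ∀ x y, ‖gradient f x - gradient f y‖ ≤ L_eq * ‖x - y‖)
    (hbdd : ∃ c : ℝ, ∀ x, c ≤ f x)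
    (γ : ℝ) (hγ0 : 0 < γ) (hγ : γ ≤ 1 / L_eq)
    (x : ℕ → EuclideanSpace ℝ (Fin m))
    (hx : ∀ n, x (n + 1) = x n - γ • gradient f (x n))
    (xstar : EuclideanSpace ℝ (Fin m))
    (hcluster : ∃ φ : ℕ → ℕ, StrictMono φ ∧
      Tendsto (fun n => x (φ n)) atTop (𝓝 xstar)) :
    gradient f xstar = 0 := by
  obtain ⟨φ, hφ, hφx⟩ := hcluster
  have hcont : Continuous (gradient f) :=
    (LipschitzWith.of_dist_le' fun x y => by simpa [dist_eq_norm] using hlip x y).continuous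
  exact tendsto_nhds_unique ((hcont.tendsto xstar).comp hφx)
    ((tendsto_gradient_of_gradient_descent hf hL hlip hbdd hγ0 hγ hx).comp hφ.tendsto_atTop)
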